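/- There is an absolute constant K such that for all t ≥ 3 and all primes p ≤ t, |Σ_{n≤t} d^{(1)}(n)·α(pn)/n − (6/π²)·((1/210)·l⁷ + (1/72)·l⁶·log p)| ≤ K·(l⁶ + l⁷/p), where l = log t. -/

import Mathlib

/-- `d^{(1)}(n) = Σ_{ab=n} log a`. -/
noncomputable def dOne (n : ℕ) : ℝ :=
  ∑ x ∈ n.divisorsAntidiagonal, Real.log x.1

/-- `α(n) = d^{(1,1)}(n) = Σ_{ab=n} (log a)(log b)`. -/
noncomputable def alphaFn (n : ℕ) : ℝ :=
  ∑ x ∈ n.divisorsAntidiagonal, Real.log x.1 * Real.log x.2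

open Finset
open scoped Nat

/-- `w` has logarithmic mean value `c / (i + 1)! * (log t) ^ (i + 1)`, with an error that saves one
power of the logarithm. -/
def LogMean (w : ℕ → ℝ) (c : ℝ) (i : ℕ) : Prop :=
  ∃ K : ℝ, 0 ≤ K ∧ ∀ t : ℝ, 1 ≤ t →
    |∑ n ∈ Icc 1 ⌊t⌋₊, w n / n - c / (i + 1)! * Real.log t ^ (i + 1)| ≤ K * (1 + Real.log t) ^ i

/-- Dirichlet convolution of two sequences. -/
def dirichletConv (u v : ℕ → ℝ) (n : ℕ) : ℝ :=
  ∑ x ∈ n.divisorsAntidiagonal, u x.1 * v x.2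

lemma LogMean.congr {u v : ℕ → ℝ} {c : ℝ} {i : ℕ} (h : LogMean u c i)
    (huv : ∀ n, 1 ≤ n → u n = v n) : LogMean v c i := by
  obtain ⟨K, hK, h⟩ := h
  refine ⟨K, hK, fun t ht => ?_⟩
  have e : ∑ n ∈ Icc 1 ⌊t⌋₊, v n / n = ∑ n ∈ Icc 1 ⌊t⌋₊, u n / n :=
    sum_congr rfl fun n hn => by rw [huv n (mem_Icc.1 hn).1]
  rw [e]
  exact h t ht

lemma LogMean.add {u v : ℕ → ℝ} {c d : ℝ} {i : ℕ} (hu : LogMean u c i) (hv : LogMean v d i) :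
    LogMean (fun n => u n + v n) (c + d) i := by
  obtain ⟨K, hK, hu⟩ := hu
  obtain ⟨M, hM, hv⟩ := hv
  refine ⟨K + M, by positivity, fun t ht => ?_⟩
  have := (abs_add_le _ _).trans (add_le_add (hu t ht) (hv t ht))
  rw [add_mul]
  refine le_trans (le_of_eq (congrArg _ ?_)) this
  simp only [add_div, sum_add_distrib]
  ring

lemma abs_pow_succ_sub_pow_succ_sub_le (x y : ℝ) (hy : 0 ≤ y) (hxy : y ≤ x) (a : ℕ) :
    |x ^ (a + 1) - y ^ (a + 1) - (a + 1) * x ^ a * (x - y)| ≤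
      a ^ 2 * (1 + x) ^ a * (x - y) ^ 2 := by
  have hx : 0 ≤ x := hy.trans hxy
  induction a with
  | zero => simp
  | succ a ih =>
    have h1 := abs_pow_sub_pow_le y x (a + 1)
    rw [max_eq_right (by rwa [abs_of_nonneg hx, abs_of_nonneg hy]), abs_of_nonneg hx,
      abs_sub_comm y x, abs_of_nonneg (sub_nonneg.2 hxy), Nat.add_sub_cancel] at h1
    have e : x ^ (a + 1 + 1) - y ^ (a + 1 + 1) - ((a + 1 : ℕ) + 1) * x ^ (a + 1) * (x - y) =
        x * (x ^ (a + 1) - y ^ (a + 1) - (a + 1) * x ^ a * (x - y)) +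
          (x - y) * (y ^ (a + 1) - x ^ (a + 1)) := by push_cast; ring
    rw [e]
    refine (abs_add_le _ _).trans ?_
    rw [abs_mul, abs_mul, abs_of_nonneg hx, abs_of_nonneg (sub_nonneg.2 hxy)]
    have h2 : x ^ a ≤ (1 + x) ^ (a + 1) := by
      calc x ^ a ≤ (1 + x) ^ a := by gcongr; linarith
        _ ≤ _ := pow_le_pow_right₀ (by linarith) (by lia)
    have hd : 0 ≤ x - y := sub_nonneg.2 hxy
    calc _ ≤ (1 + x) * (a ^ 2 * (1 + x) ^ a * (x - y) ^ 2) +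
          (x - y) * ((x - y) * (a + 1 : ℕ) * (1 + x) ^ (a + 1)) := by
          gcongr
          · linarith
          · exact h1.trans (by gcongr)
      _ = (a ^ 2 + a + 1) * (1 + x) ^ (a + 1) * (x - y) ^ 2 := by push_cast; ring
      _ ≤ _ := by
        gcongr
        push_cast
        nlinarith [(Nat.cast_nonneg a : (0 : ℝ) ≤ a)]

lemma log_succ_sub_log_bounds (m : ℕ) (hm : 1 ≤ m) :
    1 / ((m : ℝ) + 1) ≤ Real.log (m + 1) - Real.log m ∧
      Real.log (m + 1) - Real.log m ≤ 1 / m := by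
  have hm' : (0 : ℝ) < m := by exact_mod_cast hm
  rw [← Real.log_div (by positivity) (by positivity)]
  constructor
  · refine le_trans (le_of_eq ?_) (Real.one_sub_inv_le_log_of_pos (by positivity))
    field_simp; ring
  · refine (Real.log_le_sub_one_of_pos (by positivity)).trans (le_of_eq ?_)
    field_simp; ring

lemma abs_log_pow_div_sub_le (a m : ℕ) (hm : 1 ≤ m) :
    |(a + 1) * (Real.log (m + 1) ^ a / (m + 1)) -
        (Real.log (m + 1) ^ (a + 1) - Real.log m ^ (a + 1))| ≤
      2 * (a + 1) ^ 2 * (1 + Real.log (m + 1)) ^ a * (1 / m - 1 / (m + 1)) := by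
  have hm' : (1 : ℝ) ≤ m := by exact_mod_cast hm
  obtain ⟨h1, h2⟩ := log_succ_sub_log_bounds m hm
  have hy : 0 ≤ Real.log m := Real.log_natCast_nonneg m
  set x := Real.log (m + 1)
  set y := Real.log m
  have hp : 0 < 1 / ((m : ℝ) + 1) := by positivity
  have hxy : y ≤ x := by linarith
  have h3 := abs_pow_succ_sub_pow_succ_sub_le x y hy hxy a
  have hx : 0 ≤ x := hy.trans hxy
  have e : (a + 1) * (x ^ a / (m + 1)) - (x ^ (a + 1) - y ^ (a + 1)) =
      -(x ^ (a + 1) - y ^ (a + 1) - (a + 1) * x ^ a * (x - y)) -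
        (a + 1) * x ^ a * (x - y - 1 / (m + 1)) := by ring
  have e2 : 1 / (m : ℝ) - 1 / (m + 1) = 1 / (m * (m + 1)) := by field_simp; ring
  rw [e]
  refine (abs_sub _ _).trans ?_
  rw [abs_neg, abs_mul _ (x - y - 1 / (m + 1)), abs_of_nonneg (by positivity : 0 ≤ (a + 1) * x ^ a),
    abs_of_nonneg (by linarith : 0 ≤ x - y - 1 / ((m : ℝ) + 1))]
  have h4 : (x - y) ^ 2 ≤ 2 * (1 / m - 1 / (m + 1)) := by
    calc (x - y) ^ 2 ≤ (1 / m) ^ 2 := by gcongr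
      _ ≤ _ := by
        rw [e2, div_pow, one_pow, mul_one_div, div_le_div_iff₀ (by positivity) (by positivity)]
        nlinarith
  have h0 : 0 ≤ 1 / (m : ℝ) - 1 / (m + 1) := by rw [e2]; positivity
  calc _ ≤ a ^ 2 * (1 + x) ^ a * (2 * (1 / m - 1 / (m + 1))) +
        (a + 1) * (1 + x) ^ a * (1 / m - 1 / (m + 1)) := by
        gcongr
        · refine h3.trans (by gcongr)
        · linarith
    _ = (2 * a ^ 2 + a + 1) * (1 + x) ^ a * (1 / m - 1 / (m + 1)) := by ring
    _ ≤ _ := by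
      gcongr
      nlinarith [(Nat.cast_nonneg a : (0 : ℝ) ≤ a)]

lemma abs_sum_log_pow_div_sub_le (a N : ℕ) (hN : 1 ≤ N) :
    |(a + 1) * ∑ m ∈ Icc 1 N, Real.log m ^ a / m - Real.log N ^ (a + 1)| ≤
      2 * (a + 1) ^ 2 * (1 + Real.log N) ^ a * (2 - 1 / N) := by
  induction N, hN using Nat.le_induction with
  | base =>
    have : (0 : ℝ) ^ a ≤ 1 := pow_le_one₀ le_rfl zero_le_one
    simp
    rw [abs_of_nonneg (by positivity)]
    nlinarith [(Nat.cast_nonneg a : (0 : ℝ) ≤ a), (by positivity : 0 ≤ (0 : ℝ) ^ a)]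
  | succ N hN ih =>
    have hN' : (1 : ℝ) ≤ N := by exact_mod_cast hN
    rw [sum_Icc_succ_top (by lia)]
    push_cast
    have h := abs_log_pow_div_sub_le a N hN
    have hlog : Real.log N ≤ Real.log (N + 1) := Real.log_le_log (by positivity) (by linarith)
    have h0 : 0 ≤ Real.log N := Real.log_natCast_nonneg N
    have h1 : 0 ≤ 2 - 1 / (N : ℝ) := by
      have : 1 / (N : ℝ) ≤ 1 := by rw [div_le_one (by positivity)]; exact hN'
      linarith
    calc _ = |((a + 1) * ∑ m ∈ Icc 1 N, Real.log m ^ a / m - Real.log N ^ (a + 1)) +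
          ((a + 1) * (Real.log (N + 1) ^ a / (N + 1)) -
          (Real.log (N + 1) ^ (a + 1) - Real.log N ^ (a + 1)))| := by congr 1; ring
      _ ≤ 2 * (a + 1) ^ 2 * (1 + Real.log (N + 1)) ^ a * (2 - 1 / N) +
          2 * (a + 1) ^ 2 * (1 + Real.log (N + 1)) ^ a * (1 / N - 1 / (N + 1)) := by
          refine (abs_add_le _ _).trans (add_le_add (ih.trans ?_) h)
          gcongr
      _ = _ := by ring

lemma one_le_floor_of_one_le {t : ℝ} (ht : 1 ≤ t) : 1 ≤ ⌊t⌋₊ := (Nat.one_le_floor_iff t).2 ht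

lemma LogMean.log_pow (a : ℕ) : LogMean (fun n => Real.log n ^ a) (a !) a := by
  refine ⟨4 * (a + 1) ^ 2 + (a + 1), by positivity, fun t ht => ?_⟩
  have hN := one_le_floor_of_one_le ht
  have h := abs_sum_log_pow_div_sub_le a ⌊t⌋₊ hN
  set N := ⌊t⌋₊
  have hN' : (1 : ℝ) ≤ N := by exact_mod_cast hN
  have hNt : (N : ℝ) ≤ t := Nat.floor_le (by linarith)
  have htN : t < N + 1 := Nat.lt_floor_add_one t
  have hlog : Real.log N ≤ Real.log t := Real.log_le_log (by positivity) hNt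
  have h0 : 0 ≤ Real.log N := Real.log_natCast_nonneg N
  have hL : 0 ≤ Real.log t := h0.trans hlog
  have h1 : Real.log t - Real.log N ≤ 1 := by
    rw [← Real.log_div (by positivity) (by positivity)]
    refine (Real.log_le_sub_one_of_pos (by positivity)).trans ?_
    have : t / N ≤ 2 := by rw [div_le_iff₀ (by positivity)]; linarith
    linarith
  have h2 := abs_pow_sub_pow_le (Real.log N) (Real.log t) (a + 1)
  rw [max_eq_right (by rwa [abs_of_nonneg hL, abs_of_nonneg h0]), abs_of_nonneg hL,
      abs_sub_comm (Real.log N), abs_of_nonneg (sub_nonneg.2 hlog), Nat.add_sub_cancel] at h2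
  have h3 : |(a + 1) * ∑ m ∈ Icc 1 N, Real.log m ^ a / m - Real.log t ^ (a + 1)| ≤
      (4 * (a + 1) ^ 2 + (a + 1)) * (1 + Real.log t) ^ a := by
    have e : (a + 1) * ∑ m ∈ Icc 1 N, Real.log m ^ a / m - Real.log t ^ (a + 1) =
      ((a + 1) * ∑ m ∈ Icc 1 N, Real.log m ^ a / m - Real.log N ^ (a + 1)) +
        (Real.log N ^ (a + 1) - Real.log t ^ (a + 1)) := by ring
    rw [e]
    have hinv : 0 ≤ 1 / (N : ℝ) := by positivity
    have hinv' : 1 / (N : ℝ) ≤ 1 := by rw [div_le_one (by positivity)]; exact hN'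
    calc _ ≤ 2 * (a + 1) ^ 2 * (1 + Real.log N) ^ a * (2 - 1 / N) +
          (Real.log t - Real.log N) * (a + 1 : ℕ) * Real.log t ^ a :=
          (abs_add_le _ _).trans (add_le_add h h2)
      _ ≤ 2 * (a + 1) ^ 2 * (1 + Real.log t) ^ a * 2 + 1 * (a + 1 : ℕ) * (1 + Real.log t) ^ a := by
          gcongr <;> linarith
      _ = _ := by push_cast; ring
  have e : ∑ n ∈ Icc 1 N, Real.log n ^ a / n - (a ! : ℝ) / (a + 1)! * Real.log t ^ (a + 1) =
      ((a + 1) * ∑ m ∈ Icc 1 N, Real.log m ^ a / m - Real.log t ^ (a + 1)) / (a + 1) := by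
    rw [Nat.factorial_succ]
    push_cast
    field_simp
  rw [e, abs_div, abs_of_nonneg (by positivity : (0 : ℝ) ≤ a + 1)]
  exact (div_le_self (abs_nonneg _) (by linarith [(Nat.cast_nonneg a : (0 : ℝ) ≤ a)])).trans h3

/-- The one-variable analogue of the Beta integral. -/
lemma exists_abs_sum_log_pow_mul_le (j : ℕ) : ∀ a : ℕ, ∃ K : ℝ, 0 ≤ K ∧ ∀ t : ℝ, 1 ≤ t →
    |∑ m ∈ Icc 1 ⌊t⌋₊, Real.log m ^ a * Real.log (t / m) ^ j / m -
        (a ! * j ! / (a + j + 1)! : ℝ) * Real.log t ^ (a + j + 1)| ≤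
      K * (1 + Real.log t) ^ (a + j) := by
  induction j with
  | zero =>
    intro a
    obtain ⟨K, hK, h⟩ := LogMean.log_pow a
    exact ⟨K, hK, fun t ht => by simpa using h t ht⟩
  | succ j ih =>
    intro a
    obtain ⟨K, hK, h⟩ := ih a
    obtain ⟨M, hM, h'⟩ := ih (a + 1)
    refine ⟨K + M, by positivity, fun t ht => ?_⟩
    have hL : 0 ≤ Real.log t := Real.log_nonneg ht
    have h1 := h t ht
    have h2 := h' t ht
    have es : ∑ m ∈ Icc 1 ⌊t⌋₊, Real.log m ^ a * Real.log (t / m) ^ (j + 1) / m =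
        Real.log t * ∑ m ∈ Icc 1 ⌊t⌋₊, Real.log m ^ a * Real.log (t / m) ^ j / m -
          ∑ m ∈ Icc 1 ⌊t⌋₊, Real.log m ^ (a + 1) * Real.log (t / m) ^ j / m := by
      rw [mul_sum, ← sum_sub_distrib]
      refine sum_congr rfl fun m hm => ?_
      have : (m : ℝ) ≠ 0 := by have := (mem_Icc.1 hm).1; positivity
      rw [pow_succ (Real.log (t / m)), pow_succ (Real.log m)]
      nth_rw 2 [Real.log_div (by positivity) this]
      ring
    have ec : (a ! * (j + 1)! / (a + (j + 1) + 1)! : ℝ) =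
        a ! * j ! / (a + j + 1)! - (a + 1)! * j ! / (a + 1 + j + 1)! := by
      rw [show a + (j + 1) + 1 = (a + j + 1) + 1 by ring,
        show a + 1 + j + 1 = (a + j + 1) + 1 by ring, Nat.factorial_succ (a + j + 1),
        Nat.factorial_succ j, Nat.factorial_succ a]
      push_cast
      field_simp
      ring
    rw [es, ec]
    have e : a + 1 + j = a + (j + 1) := by ring
    rw [e] at h2 ⊢
    set S := ∑ m ∈ Icc 1 ⌊t⌋₊, Real.log m ^ a * Real.log (t / m) ^ j / m
    set T := ∑ m ∈ Icc 1 ⌊t⌋₊, Real.log m ^ (a + 1) * Real.log (t / m) ^ j / m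
    set c : ℝ := a ! * j ! / (a + j + 1)!
    set d : ℝ := (a + 1)! * j ! / (a + (j + 1) + 1)!
    calc _ = |Real.log t * (S - c * Real.log t ^ (a + j + 1)) -
          (T - d * Real.log t ^ (a + (j + 1) + 1))| := by congr 1; ring
      _ ≤ (1 + Real.log t) * (K * (1 + Real.log t) ^ (a + j)) +
          M * (1 + Real.log t) ^ (a + (j + 1)) := by
        refine (abs_sub _ _).trans (add_le_add ?_ h2)
        rw [abs_mul, abs_of_nonneg hL]
        gcongr
        linarith
      _ = _ := by ring

lemma LogMean.exists_abs_sum_le {w : ℕ → ℝ} {c : ℝ} {i : ℕ} (h : LogMean w c i) :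
    ∃ K : ℝ, 0 ≤ K ∧ ∀ t : ℝ, 1 ≤ t →
      |∑ n ∈ Icc 1 ⌊t⌋₊, w n / n| ≤ K * (1 + Real.log t) ^ (i + 1) := by
  obtain ⟨K, hK, h⟩ := h
  refine ⟨K + |c / (i + 1)!|, by positivity, fun t ht => ?_⟩
  have hL : 0 ≤ Real.log t := Real.log_nonneg ht
  have h1 := h t ht
  set S := ∑ n ∈ Icc 1 ⌊t⌋₊, w n / n
  calc |S| = |(S - c / (i + 1)! * Real.log t ^ (i + 1)) + c / (i + 1)! * Real.log t ^ (i + 1)| := by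
        congr 1; ring
    _ ≤ K * (1 + Real.log t) ^ i + |c / (i + 1)!| * Real.log t ^ (i + 1) := by
        refine (abs_add_le _ _).trans (add_le_add h1 ?_)
        rw [abs_mul, abs_of_nonneg (by positivity : 0 ≤ Real.log t ^ (i + 1))]
    _ ≤ K * (1 + Real.log t) ^ (i + 1) + |c / (i + 1)!| * (1 + Real.log t) ^ (i + 1) := by
        gcongr <;> linarith
    _ = _ := by ring

lemma sum_sum_divisorsAntidiagonal (f : ℕ → ℕ → ℝ) (N : ℕ) :
    ∑ n ∈ Icc 1 N, ∑ x ∈ n.divisorsAntidiagonal, f x.1 x.2 =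
      ∑ a ∈ Icc 1 N, ∑ b ∈ Icc 1 (N / a), f a b := by
  rw [sum_sigma', sum_sigma']
  refine sum_bij' (fun x _ => ⟨x.2.1, x.2.2⟩) (fun x _ => ⟨x.1 * x.2, (x.1, x.2)⟩) ?_ ?_ ?_ ?_ ?_
  · rintro ⟨n, a, b⟩ h
    simp only [mem_sigma, mem_Icc, Nat.mem_divisorsAntidiagonal] at h ⊢
    obtain ⟨⟨h1, h2⟩, rfl, -⟩ := h
    have ha : 0 < a := Nat.pos_of_ne_zero (by rintro rfl; simp at h1)
    have hb : 0 < b := Nat.pos_of_ne_zero (by rintro rfl; simp at h1)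
    refine ⟨⟨ha, (Nat.le_mul_of_pos_right a hb).trans h2⟩, hb, ?_⟩
    rw [Nat.le_div_iff_mul_le ha, mul_comm]
    exact h2
  · rintro ⟨a, b⟩ h
    simp only [mem_sigma, mem_Icc, Nat.mem_divisorsAntidiagonal] at h ⊢
    obtain ⟨⟨h1, h2⟩, h3, h4⟩ := h
    rw [Nat.le_div_iff_mul_le h1, mul_comm] at h4
    have := Nat.mul_pos h1 h3
    exact ⟨⟨this, h4⟩, trivial, this.ne'⟩
  · rintro ⟨n, a, b⟩ h
    simp only [mem_sigma, mem_Icc, Nat.mem_divisorsAntidiagonal] at h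
    obtain ⟨-, rfl, -⟩ := h
    rfl
  · rintro ⟨a, b⟩ h
    rfl
  · rintro ⟨n, a, b⟩ h
    rfl

lemma sum_sum_divisorsAntidiagonal_eq_ite (f : ℕ → ℕ → ℝ) {M N : ℕ} (hMN : M ≤ N) :
    ∑ n ∈ Icc 1 M, ∑ x ∈ n.divisorsAntidiagonal, f x.1 x.2 =
      ∑ a ∈ Icc 1 N, ∑ b ∈ Icc 1 N, if a * b ≤ M then f a b else 0 := by
  rw [sum_sum_divisorsAntidiagonal]
  have h1 : ∀ a ∈ Icc 1 N, (∑ b ∈ Icc 1 N, if a * b ≤ M then f a b else 0) =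
      ∑ b ∈ Icc 1 (M / a), f a b := by
    intro a ha
    rw [← sum_filter]
    congr 1
    ext b
    have ha1 := (mem_Icc.1 ha).1
    simp only [mem_filter, mem_Icc, Nat.le_div_iff_mul_le ha1]
    constructor
    · rintro ⟨⟨h1, h2⟩, h3⟩
      exact ⟨h1, by rwa [mul_comm]⟩
    · rintro ⟨h1, h2⟩
      exact ⟨⟨h1, by nlinarith⟩, by rwa [mul_comm]⟩
  rw [sum_congr rfl h1]
  refine sum_subset (Icc_subset_Icc_right hMN) fun a ha ha' => ?_
  have : M / a = 0 := by
    simp only [mem_Icc] at ha ha'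
    exact Nat.div_eq_of_lt (by lia)
  simp [this]

lemma sum_dirichletConv_div (u v : ℕ → ℝ) (t : ℝ) :
    ∑ n ∈ Icc 1 ⌊t⌋₊, dirichletConv u v n / n =
      ∑ m ∈ Icc 1 ⌊t⌋₊, u m / m * ∑ k ∈ Icc 1 ⌊t / m⌋₊, v k / k := by
  have h := sum_sum_divisorsAntidiagonal (fun a b => u a / a * (v b / b)) ⌊t⌋₊
  simp only [← Nat.floor_div_natCast, ← mul_sum] at h
  rw [← h]
  refine sum_congr rfl fun n hn => ?_
  rw [dirichletConv, sum_div]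
  refine sum_congr rfl fun x hx => ?_
  rw [← (Nat.mem_divisorsAntidiagonal.1 hx).1]
  push_cast
  rw [mul_div_mul_comm]

lemma LogMean.log_pow_conv {v : ℕ → ℝ} {d : ℝ} {j : ℕ} (h : LogMean v d j) (a : ℕ) :
    LogMean (dirichletConv (fun n => Real.log n ^ a) v) (d * a !) (a + j + 1) := by
  obtain ⟨M, hM, h⟩ := h
  obtain ⟨K, hK, hB⟩ := exists_abs_sum_log_pow_mul_le (j + 1) a
  obtain ⟨B, hB0, hS⟩ := (LogMean.log_pow a).exists_abs_sum_le
  refine ⟨M * B + |d / (j + 1)!| * K, by positivity, fun t ht => ?_⟩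
  have hL : 0 ≤ Real.log t := Real.log_nonneg ht
  have hB := hB t ht
  have hS := hS t ht
  rw [sum_dirichletConv_div]
  set c : ℝ := d / (j + 1)! with hc
  set L := Real.log t
  have e : ∑ m ∈ Icc 1 ⌊t⌋₊, Real.log m ^ a / m * ∑ k ∈ Icc 1 ⌊t / m⌋₊, v k / k -
      d * a ! / (a + j + 1 + 1)! * L ^ (a + j + 1 + 1) =
      ∑ m ∈ Icc 1 ⌊t⌋₊, Real.log m ^ a / m * (∑ k ∈ Icc 1 ⌊t / m⌋₊, v k / k -
        c * Real.log (t / m) ^ (j + 1)) +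
      c * (∑ m ∈ Icc 1 ⌊t⌋₊, Real.log m ^ a * Real.log (t / m) ^ (j + 1) / m -
        (a ! * (j + 1)! / (a + (j + 1) + 1)! : ℝ) * L ^ (a + (j + 1) + 1)) := by
    rw [mul_sub, mul_sum, ← add_sub_assoc, ← sum_add_distrib]
    congr 1
    · exact sum_congr rfl fun m _ => by ring
    · rw [hc, ← add_assoc]
      field_simp
  rw [e]
  have h1 : |∑ m ∈ Icc 1 ⌊t⌋₊, Real.log m ^ a / m * (∑ k ∈ Icc 1 ⌊t / m⌋₊, v k / k -
        c * Real.log (t / m) ^ (j + 1))| ≤ M * (1 + L) ^ j * (B * (1 + L) ^ (a + 1)) := by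
    refine (abs_sum_le_sum_abs _ _).trans ?_
    calc _ ≤ ∑ m ∈ Icc 1 ⌊t⌋₊, Real.log m ^ a / m * (M * (1 + L) ^ j) := by
          refine sum_le_sum fun m hm => ?_
          obtain ⟨hm1, hm2⟩ := mem_Icc.1 hm
          have hm0 : (1 : ℝ) ≤ m := by exact_mod_cast hm1
          have hmt : (m : ℝ) ≤ t := (Nat.le_floor_iff (by linarith)).1 hm2
          have hlm : 0 ≤ Real.log m := Real.log_natCast_nonneg m
          have hs : 1 ≤ t / m := by rwa [one_le_div (by positivity)]
          rw [abs_mul, abs_of_nonneg (by positivity)]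
          gcongr
          refine (h _ hs).trans ?_
          have := Real.log_nonneg hs
          have h2 : Real.log (t / m) ≤ L := Real.log_le_log (by positivity)
            (div_le_self (by linarith) hm0)
          gcongr
      _ = M * (1 + L) ^ j * ∑ m ∈ Icc 1 ⌊t⌋₊, Real.log m ^ a / m := by
          rw [← sum_mul, mul_comm]
      _ ≤ _ := by
          gcongr
          exact (le_abs_self _).trans hS
  calc _ ≤ M * (1 + L) ^ j * (B * (1 + L) ^ (a + 1)) +
        |c| * (K * (1 + L) ^ (a + (j + 1))) := by
        refine (abs_add_le _ _).trans (add_le_add h1 ?_)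
        rw [abs_mul]
        gcongr
    _ = _ := by ring

lemma sum_Icc_dvd (f : ℕ → ℝ) {k N : ℕ} (hk : 1 ≤ k) (hf : ∀ x, N < x → f x = 0) :
    (∑ x ∈ Icc 1 N, if k ∣ x then f x else 0) = ∑ x ∈ Icc 1 N, f (k * x) := by
  have h1 : ∑ x ∈ Icc 1 N, f (k * x) = ∑ x ∈ Icc 1 (N / k), f (k * x) := by
    refine (sum_subset (Icc_subset_Icc_right (Nat.div_le_self N k)) fun x hx hx' => ?_).symm
    refine hf _ ?_
    by_contra! h
    refine hx' (mem_Icc.2 ⟨(mem_Icc.1 hx).1, ?_⟩)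
    rwa [Nat.le_div_iff_mul_le hk, mul_comm]
  rw [h1, ← sum_filter]
  refine sum_bij' (fun x _ => x / k) (fun x _ => k * x) ?_ ?_ ?_ ?_ ?_
  · intro x hx
    obtain ⟨hx, y, rfl⟩ := mem_filter.1 hx
    rw [Nat.mul_div_cancel_left _ hk, mem_Icc, Nat.le_div_iff_mul_le hk, mul_comm y]
    obtain ⟨h1, h2⟩ := mem_Icc.1 hx
    exact ⟨Nat.pos_of_ne_zero (by rintro rfl; simp at h1), h2⟩
  · intro x hx
    rw [mem_Icc, Nat.le_div_iff_mul_le hk, mul_comm x] at hx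
    exact mem_filter.2 ⟨mem_Icc.2 ⟨Nat.mul_pos hk hx.1, hx.2⟩, dvd_mul_right _ _⟩
  · intro x hx
    exact Nat.mul_div_cancel' (mem_filter.1 hx).2
  · intro x hx
    exact Nat.mul_div_cancel_left _ hk
  · intro x hx
    rw [Nat.mul_div_cancel' (mem_filter.1 hx).2]

lemma ite_coprime_eq_sum_moebius {x y N : ℕ} (hx : 1 ≤ x) (hxN : x ≤ N) :
    (if x.Coprime y then (1 : ℝ) else 0) =
      ∑ k ∈ Icc 1 N, if k ∣ x then if k ∣ y then (ArithmeticFunction.moebius k : ℝ) else 0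
        else 0 := by
  have hg : x.gcd y ≠ 0 := Nat.gcd_ne_zero_left (by lia)
  have h := congrArg (fun f : ArithmeticFunction ℤ => f (x.gcd y))
    ArithmeticFunction.moebius_mul_coe_zeta
  simp only [ArithmeticFunction.coe_mul_zeta_apply, ArithmeticFunction.one_apply] at h
  have h' : (if x.Coprime y then (1 : ℝ) else 0) =
      ((∑ i ∈ (x.gcd y).divisors, ArithmeticFunction.moebius i : ℤ) : ℝ) := by
    rw [h]
    simp [Nat.coprime_iff_gcd_eq_one]
  rw [h']
  push_cast
  simp_rw [← ite_and]
  rw [← sum_filter]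
  refine sum_congr ?_ fun _ _ => rfl
  ext k
  simp only [Nat.mem_divisors, mem_filter, mem_Icc, Nat.dvd_gcd_iff]
  constructor
  · rintro ⟨⟨h1, h2⟩, -⟩
    exact ⟨⟨Nat.pos_of_dvd_of_pos h1 hx, (Nat.le_of_dvd hx h1).trans hxN⟩, h1, h2⟩
  · rintro ⟨-, h⟩
    exact ⟨h, hg⟩

lemma sum_coprime_eq_sum_moebius (H : ℕ → ℕ → ℝ) {N : ℕ}
    (hH : ∀ x y, 1 ≤ x → 1 ≤ y → N < x ∨ N < y → H x y = 0) :
    (∑ x ∈ Icc 1 N, ∑ y ∈ Icc 1 N, if x.Coprime y then H x y else 0) =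
      ∑ k ∈ Icc 1 N, (ArithmeticFunction.moebius k : ℝ) *
        ∑ x ∈ Icc 1 N, ∑ y ∈ Icc 1 N, H (k * x) (k * y) := by
  have h1 : ∀ x ∈ Icc 1 N, (∑ y ∈ Icc 1 N, if x.Coprime y then H x y else 0) =
      ∑ k ∈ Icc 1 N, if k ∣ x then ∑ y ∈ Icc 1 N,
        if k ∣ y then (ArithmeticFunction.moebius k : ℝ) * H x y else 0 else 0 := by
    intro x hx
    obtain ⟨hx1, hx2⟩ := mem_Icc.1 hx
    have : ∀ y ∈ Icc 1 N, (if x.Coprime y then H x y else 0) = ∑ k ∈ Icc 1 N,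
        if k ∣ x then if k ∣ y then (ArithmeticFunction.moebius k : ℝ) * H x y else 0 else 0 := by
      intro y _
      rw [← one_mul (H x y), ← zero_mul (H x y), ← ite_mul, ite_coprime_eq_sum_moebius hx1 hx2,
        sum_mul]
      simp only [ite_mul, zero_mul, one_mul]
    rw [sum_congr rfl this, sum_comm]
    refine sum_congr rfl fun k _ => ?_
    split_ifs <;> simp
  rw [sum_congr rfl h1, sum_comm]
  refine sum_congr rfl fun k hk => ?_
  have hk1 := (mem_Icc.1 hk).1
  rw [sum_Icc_dvd _ hk1, mul_sum]
  · refine sum_congr rfl fun x hx => ?_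
    have hx1 := (mem_Icc.1 hx).1
    have := sum_Icc_dvd (fun y => (ArithmeticFunction.moebius k : ℝ) * H (k * x) y) (N := N) hk1 ?_
    · rw [this, mul_sum]
    · intro y hy
      rw [hH _ _ (Nat.mul_pos hk1 hx1) (by lia) (Or.inr hy), mul_zero]
  · intro x hx
    refine sum_eq_zero fun y hy => ?_
    rw [hH x y (by lia) (mem_Icc.1 hy).1 (Or.inl hx), mul_zero, ite_self]

lemma hasSum_moebius_div_sq :
    HasSum (fun k : ℕ => (ArithmeticFunction.moebius k : ℝ) / k ^ 2) (6 / Real.pi ^ 2) := by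
  have h2 : 1 < (2 : ℂ).re := by norm_num
  have hs := (ArithmeticFunction.LSeriesSummable_moebius_iff.2 h2).LSeriesHasSum
  have hv : LSeries (fun n => ((ArithmeticFunction.moebius n : ℤ) : ℂ)) 2 =
      ((6 / Real.pi ^ 2 : ℝ) : ℂ) := by
    have h := ArithmeticFunction.LSeries_zeta_mul_Lseries_moebius h2
    rw [ArithmeticFunction.LSeries_zeta_eq_riemannZeta h2, riemannZeta_two] at h
    have hpi : (Real.pi : ℂ) ≠ 0 := by exact_mod_cast Real.pi_ne_zero
    push_cast
    field_simp at h ⊢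
    linear_combination h
  rw [hv, LSeriesHasSum] at hs
  rw [← Complex.hasSum_ofReal]
  convert! hs using 2 with k
  rcases eq_or_ne k 0 with rfl | hk
  · simp
  · rw [LSeries.term_of_ne_zero hk]
    push_cast
    norm_cast

/-- Dirichlet convolution restricted to coprime factorizations. -/
def coprimeConv (u v : ℕ → ℝ) (n : ℕ) : ℝ :=
  ∑ x ∈ n.divisorsAntidiagonal, if x.1.Coprime x.2 then u x.1 * v x.2 else 0

lemma sum_coprimeConv_div (u v : ℕ → ℝ) (N : ℕ) :
    ∑ n ∈ Icc 1 N, coprimeConv u v n / n =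
      ∑ k ∈ Icc 1 N, (ArithmeticFunction.moebius k : ℝ) / k ^ 2 *
        ∑ n ∈ Icc 1 (N / k ^ 2), dirichletConv (fun x => u (k * x)) (fun y => v (k * y)) n / n := by
  have h1 : ∑ n ∈ Icc 1 N, coprimeConv u v n / n =
      ∑ n ∈ Icc 1 N, ∑ x ∈ n.divisorsAntidiagonal,
        if x.1.Coprime x.2 then u x.1 * v x.2 / (x.1 * x.2 : ℕ) else 0 := by
    refine sum_congr rfl fun n _ => ?_
    rw [coprimeConv, sum_div]
    refine sum_congr rfl fun x hx => ?_
    rw [(Nat.mem_divisorsAntidiagonal.1 hx).1, ite_div, zero_div]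
  rw [h1, sum_sum_divisorsAntidiagonal_eq_ite
    (fun a b => if a.Coprime b then u a * v b / (a * b : ℕ) else 0) le_rfl]
  have h2 := sum_coprime_eq_sum_moebius (N := N)
    (fun a b => if a * b ≤ N then u a * v b / (a * b : ℕ) else 0) ?_
  · have h3 : ∀ a b : ℕ, (if a * b ≤ N then if a.Coprime b then u a * v b / (a * b : ℕ) else 0
        else 0) = if a.Coprime b then if a * b ≤ N then u a * v b / (a * b : ℕ) else 0 else 0 := by
      intro a b
      split_ifs <;> rfl
    simp_rw [h3]
    rw [h2]
    refine sum_congr rfl fun k hk => ?_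
    have hk1 := (mem_Icc.1 hk).1
    rw [div_mul_eq_mul_div, mul_div_assoc]
    congr 1
    have h4 : ∑ n ∈ Icc 1 (N / k ^ 2),
        dirichletConv (fun x => u (k * x)) (fun y => v (k * y)) n / n =
        ∑ n ∈ Icc 1 (N / k ^ 2), ∑ x ∈ n.divisorsAntidiagonal,
          u (k * x.1) * v (k * x.2) / (x.1 * x.2 : ℕ) := by
      refine sum_congr rfl fun n _ => ?_
      rw [dirichletConv, sum_div]
      refine sum_congr rfl fun x hx => ?_
      rw [(Nat.mem_divisorsAntidiagonal.1 hx).1]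
    rw [h4, sum_sum_divisorsAntidiagonal_eq_ite
      (fun a b => u (k * a) * v (k * b) / (a * b : ℕ)) (Nat.div_le_self N (k ^ 2)), sum_div]
    refine sum_congr rfl fun a _ => ?_
    rw [sum_div]
    refine sum_congr rfl fun b _ => ?_
    have : a * b ≤ N / k ^ 2 ↔ k * a * (k * b) ≤ N := by
      rw [Nat.le_div_iff_mul_le (by positivity)]
      rw [show a * b * k ^ 2 = k * a * (k * b) by ring]
    rw [ite_div, zero_div]
    simp only [this]
    congr 1
    push_cast
    rw [div_div]
    congr 1
    ring
  · intro x y hx hy h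
    rw [if_neg]
    rcases h with h | h <;> nlinarith

lemma one_add_mul_abs_pow_sub_pow_le {P X κ L : ℝ} (hX : 0 ≤ X) (hκ : 0 ≤ κ) (hP : P = κ + X)
    (hPL : P ≤ L) (c : ℕ) : (1 + L) * |P ^ c - X ^ c| ≤ c * κ * (1 + L) ^ c := by
  have h := abs_pow_sub_pow_le P X c
  have hP0 : 0 ≤ P := by linarith
  rw [abs_of_nonneg hP0, abs_of_nonneg hX, max_eq_left (by linarith), hP, add_sub_cancel_right,
    abs_of_nonneg hκ, ← hP] at h
  rcases c with _ | c
  · simp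
  · rw [Nat.add_sub_cancel] at h
    calc (1 + L) * |P ^ (c + 1) - X ^ (c + 1)| ≤
          (1 + L) * (κ * (c + 1 : ℕ) * (1 + L) ^ c) := by
          gcongr
          · linarith
          · refine h.trans ?_
            gcongr
            linarith
      _ = _ := by ring

lemma one_add_mul_abs_pow_mul_pow_sub_le {P X Q Y κ L : ℝ} (hX : 0 ≤ X) (hY : 0 ≤ Y) (hκ : 0 ≤ κ)
    (hP : P = κ + X) (hQ : Q = κ + Y) (hPL : P ≤ L) (hQL : Q ≤ L) (c e : ℕ) :
    (1 + L) * |P ^ c * Q ^ e - X ^ c * Y ^ e| ≤ (c + e) * κ * (1 + L) ^ (c + e) := by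
  have h1 := one_add_mul_abs_pow_sub_pow_le hX hκ hP hPL c
  have h2 := one_add_mul_abs_pow_sub_pow_le hY hκ hQ hQL e
  have hL : 0 ≤ L := by linarith
  have hQ0 : 0 ≤ Q := by linarith
  have e1 : P ^ c * Q ^ e - X ^ c * Y ^ e = (P ^ c - X ^ c) * Q ^ e + X ^ c * (Q ^ e - Y ^ e) := by
    ring
  calc _ ≤ (1 + L) * (|P ^ c - X ^ c| * Q ^ e + X ^ c * |Q ^ e - Y ^ e|) := by
        rw [e1]
        gcongr
        refine (abs_add_le _ _).trans (le_of_eq ?_)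
        rw [abs_mul, abs_mul, abs_of_nonneg (by positivity : 0 ≤ Q ^ e),
          abs_of_nonneg (by positivity : 0 ≤ X ^ c)]
    _ = (1 + L) * |P ^ c - X ^ c| * Q ^ e + X ^ c * ((1 + L) * |Q ^ e - Y ^ e|) := by ring
    _ ≤ c * κ * (1 + L) ^ c * (1 + L) ^ e + (1 + L) ^ c * (e * κ * (1 + L) ^ e) := by
        gcongr <;> linarith
    _ = _ := by ring

lemma abs_dirichletConv_shift_sub_le {k n : ℕ} {t : ℝ} (hk : 1 ≤ k) (hn : 1 ≤ n)
    (hkn : (k : ℝ) ^ 2 * n ≤ t) (c e : ℕ) :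
    (1 + Real.log t) * |dirichletConv (fun x => Real.log (k * x : ℕ) ^ c)
        (fun y => Real.log (k * y : ℕ) ^ e) n -
        dirichletConv (fun x => Real.log x ^ c) (fun y => Real.log y ^ e) n| ≤
      (c + e) * Real.log k * (1 + Real.log t) ^ (c + e) *
        dirichletConv (fun x => Real.log x ^ 0) (fun y => Real.log y ^ 0) n := by
  have hk' : (1 : ℝ) ≤ k := by exact_mod_cast hk
  have hn' : (1 : ℝ) ≤ n := by exact_mod_cast hn
  have ht : 1 ≤ t := le_trans (by nlinarith) hkn
  have hL : 0 ≤ Real.log t := Real.log_nonneg ht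
  unfold dirichletConv
  rw [← sum_sub_distrib, mul_sum]
  calc _ ≤ (1 + Real.log t) * ∑ x ∈ n.divisorsAntidiagonal,
        |Real.log (k * x.1 : ℕ) ^ c * Real.log (k * x.2 : ℕ) ^ e -
          Real.log x.1 ^ c * Real.log x.2 ^ e| := by
        gcongr
        exact abs_sum_le_sum_abs _ _
    _ ≤ _ := by
        rw [mul_sum]
        refine sum_le_sum fun x hx => ?_
        obtain ⟨hxn, hn0⟩ := Nat.mem_divisorsAntidiagonal.1 hx
        have hx1 : 1 ≤ x.1 := Nat.pos_of_ne_zero fun h => hn0 (by rw [← hxn, h, zero_mul])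
        have hx2 : 1 ≤ x.2 := Nat.pos_of_ne_zero fun h => hn0 (by rw [← hxn, h, mul_zero])
        have hx1' : (1 : ℝ) ≤ x.1 := by exact_mod_cast hx1
        have hx2' : (1 : ℝ) ≤ x.2 := by exact_mod_cast hx2
        have hxt : (k : ℝ) ^ 2 * (x.1 * x.2) ≤ t := by
          rw [← hxn] at hkn
          exact_mod_cast hkn
        have key : ∀ y z : ℝ, 1 ≤ y → 1 ≤ z → (k : ℝ) ^ 2 * (y * z) ≤ t →
            Real.log (k * y) ≤ Real.log t := by
          intro y z hy hz h
          refine Real.log_le_log (by positivity) (le_trans ?_ h)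
          calc (k : ℝ) * y = 1 * (k * y) * 1 := by ring
            _ ≤ k * (k * y) * z := by gcongr
            _ = _ := by ring
        simp only [pow_zero, mul_one]
        push_cast
        refine one_add_mul_abs_pow_mul_pow_sub_le (Real.log_nonneg hx1') (Real.log_nonneg hx2')
          (Real.log_nonneg hk') (Real.log_mul (by positivity) (by positivity))
          (Real.log_mul (by positivity) (by positivity)) (key _ _ hx1' hx2' hxt)
          (key _ _ hx2' hx1' (by rwa [mul_comm (x.2 : ℝ)])) c e

lemma exists_abs_sum_shift_sub_le (c e : ℕ) : ∃ K : ℝ, 0 ≤ K ∧ ∀ t : ℝ, 1 ≤ t → ∀ k : ℕ, 1 ≤ k →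
    |∑ n ∈ Icc 1 (⌊t⌋₊ / k ^ 2), dirichletConv (fun x => Real.log (k * x : ℕ) ^ c)
        (fun y => Real.log (k * y : ℕ) ^ e) n / n -
        (e ! * c ! / (c + e + 1 + 1)! : ℝ) * Real.log t ^ (c + e + 1 + 1)| ≤
      K * (1 + Real.log t) ^ (c + e + 1) * (1 + Real.log k) := by
  obtain ⟨K, hK, hV⟩ := (LogMean.log_pow e).log_pow_conv c
  obtain ⟨B, hB, hD⟩ := ((LogMean.log_pow 0).log_pow_conv 0).exists_abs_sum_le
  set C : ℝ := (e ! * c ! / (c + e + 1 + 1)! : ℝ) with hC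
  have hC0 : 0 ≤ C := by positivity
  refine ⟨(c + e) * B + K + C * (2 * (c + e + 2)), by positivity, fun t ht k hk => ?_⟩
  have hL : 0 ≤ Real.log t := Real.log_nonneg ht
  have hk' : (1 : ℝ) ≤ k := by exact_mod_cast hk
  have hκ : 0 ≤ Real.log k := Real.log_nonneg hk'
  set L := Real.log t
  set κ := Real.log k
  by_cases hkt : (k : ℝ) ^ 2 ≤ t
  · set s := t / (k ^ 2 : ℕ) with hs
    have hs1 : 1 ≤ s := by
      rw [hs, one_le_div (by positivity)]
      exact_mod_cast hkt
    have hfl : ⌊t⌋₊ / k ^ 2 = ⌊s⌋₊ := (Nat.floor_div_natCast t (k ^ 2)).symm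
    have hst : s ≤ t := div_le_self (by linarith) (by push_cast; nlinarith)
    have hls : Real.log s = L - 2 * κ := by
      rw [hs, Real.log_div (by positivity) (by positivity)]
      push_cast
      rw [Real.log_pow]
      norm_num [L, κ]
    have hls0 : 0 ≤ Real.log s := Real.log_nonneg hs1
    have hlsL : Real.log s ≤ L := Real.log_le_log (by positivity) hst
    rw [hfl]
    have h1 : |∑ n ∈ Icc 1 ⌊s⌋₊, dirichletConv (fun x => Real.log (k * x : ℕ) ^ c)
        (fun y => Real.log (k * y : ℕ) ^ e) n / n -
        ∑ n ∈ Icc 1 ⌊s⌋₊, dirichletConv (fun x => Real.log x ^ c)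
        (fun y => Real.log y ^ e) n / n| ≤ (c + e) * κ * (1 + L) ^ (c + e) * (B * (1 + L)) := by
      rw [← sum_sub_distrib]
      have h2 : (1 + L) * |∑ n ∈ Icc 1 ⌊s⌋₊, (dirichletConv (fun x => Real.log (k * x : ℕ) ^ c)
          (fun y => Real.log (k * y : ℕ) ^ e) n / n -
          dirichletConv (fun x => Real.log x ^ c) (fun y => Real.log y ^ e) n / n)| ≤
          (c + e) * κ * (1 + L) ^ (c + e) * (B * (1 + L) ^ 2) := by
        calc _ ≤ (1 + L) * ∑ n ∈ Icc 1 ⌊s⌋₊, |dirichletConv (fun x => Real.log (k * x : ℕ) ^ c)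
              (fun y => Real.log (k * y : ℕ) ^ e) n / n -
              dirichletConv (fun x => Real.log x ^ c) (fun y => Real.log y ^ e) n / n| := by
              gcongr
              exact abs_sum_le_sum_abs _ _
          _ ≤ ∑ n ∈ Icc 1 ⌊s⌋₊, (c + e) * κ * (1 + L) ^ (c + e) *
              (dirichletConv (fun x => Real.log x ^ 0) (fun y => Real.log y ^ 0) n / n) := by
              rw [mul_sum]
              refine sum_le_sum fun n hn => ?_
              obtain ⟨hn1, hn2⟩ := mem_Icc.1 hn
              have hn0 : (0 : ℝ) < n := by exact_mod_cast hn1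
              rw [← sub_div, abs_div, abs_of_pos hn0, ← mul_div_assoc, ← mul_div_assoc]
              refine div_le_div_of_nonneg_right ?_ hn0.le
              refine abs_dirichletConv_shift_sub_le hk hn1 ?_ c e
              have := (Nat.le_floor_iff (by linarith)).1 hn2
              rw [hs, le_div_iff₀ (by positivity)] at this
              push_cast at this
              linarith
          _ ≤ _ := by
              rw [← mul_sum]
              gcongr
              refine (le_abs_self _).trans ((hD s hs1).trans ?_)
              gcongr
      have h3 : 0 < 1 + L := by linarith
      refine le_of_mul_le_mul_left (h2.trans (le_of_eq ?_)) h3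
      ring
    have h4 := hV s hs1
    have h5 := abs_pow_sub_pow_le (Real.log s) L (c + e + 1 + 1)
    rw [max_eq_right (by rwa [abs_of_nonneg hls0, abs_of_nonneg hL]), abs_of_nonneg hL,
      abs_sub_comm (Real.log s) L, abs_of_nonneg (sub_nonneg.2 hlsL), Nat.add_sub_cancel] at h5
    set S := ∑ n ∈ Icc 1 ⌊s⌋₊, dirichletConv (fun x => Real.log (k * x : ℕ) ^ c)
        (fun y => Real.log (k * y : ℕ) ^ e) n / n
    set T := ∑ n ∈ Icc 1 ⌊s⌋₊, dirichletConv (fun x => Real.log x ^ c)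
        (fun y => Real.log y ^ e) n / n
    have hκ1 : κ ≤ 1 + κ := by linarith
    have h6 : K * (1 + Real.log s) ^ (c + e + 1) ≤ K * (1 + L) ^ (c + e + 1) * (1 + κ) :=
      calc _ ≤ K * (1 + L) ^ (c + e + 1) := by gcongr
        _ ≤ _ := le_mul_of_one_le_right (by positivity) (by linarith)
    calc _ = |(S - T) + (T - C * Real.log s ^ (c + e + 1 + 1)) +
          C * (Real.log s ^ (c + e + 1 + 1) - L ^ (c + e + 1 + 1))| := by congr 1; ring
      _ ≤ (c + e) * κ * (1 + L) ^ (c + e) * (B * (1 + L)) + K * (1 + Real.log s) ^ (c + e + 1) +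
          C * ((L - Real.log s) * (c + e + 1 + 1 : ℕ) * L ^ (c + e + 1)) := by
          refine (abs_add_le _ _).trans (add_le_add ((abs_add_le _ _).trans (add_le_add h1 h4)) ?_)
          rw [abs_mul, abs_of_nonneg hC0]
          gcongr
      _ ≤ (c + e) * (1 + κ) * (1 + L) ^ (c + e) * (B * (1 + L)) +
          K * (1 + L) ^ (c + e + 1) * (1 + κ) +
          C * (2 * (1 + κ) * (c + e + 1 + 1 : ℕ) * (1 + L) ^ (c + e + 1)) := by
          refine add_le_add (add_le_add ?_ h6) ?_
          · gcongr
          · gcongr <;> linarith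
      _ = _ := by push_cast; ring
  · have h0 : ⌊t⌋₊ / k ^ 2 = 0 := by
      refine Nat.div_eq_of_lt ((Nat.floor_lt (by linarith)).2 ?_)
      push_cast
      linarith
    have hLκ : L ≤ 2 * κ := by
      have := Real.log_le_log (by linarith) (not_le.1 hkt).le
      rw [Real.log_pow] at this
      exact_mod_cast this
    rw [h0]
    simp only [Icc_eq_empty (by norm_num : ¬ 1 ≤ 0), sum_empty, zero_sub, abs_neg]
    rw [abs_of_nonneg (by positivity)]
    calc C * L ^ (c + e + 1 + 1) = C * L * L ^ (c + e + 1) := by ring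
      _ ≤ C * (2 * (1 + κ)) * (1 + L) ^ (c + e + 1) := by
          gcongr <;> linarith
      _ = (C * 2) * ((1 + L) ^ (c + e + 1) * (1 + κ)) := by ring
      _ ≤ ((c + e) * B + K + C * (2 * (c + e + 2))) * ((1 + L) ^ (c + e + 1) * (1 + κ)) := by
          gcongr
          have : 0 ≤ (c + e) * B := by positivity
          have h2 : C * 2 ≤ C * (2 * (c + e + 2)) := by
            gcongr
            have : (0 : ℝ) ≤ c + e := by positivity
            linarith
          linarith
      _ = _ := by ring

lemma summable_one_add_log_div_sq : Summable fun k : ℕ => (1 + Real.log k) / (k : ℝ) ^ 2 := by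
  have h : Summable fun k : ℕ => 3 * (1 / (k : ℝ) ^ (3 / 2 : ℝ)) :=
    (Real.summable_one_div_nat_rpow.2 (by norm_num)).mul_left 3
  refine Summable.of_nonneg_of_le (fun k => ?_) (fun k => ?_) h
  · have := Real.log_natCast_nonneg k
    positivity
  · rcases Nat.eq_zero_or_pos k with rfl | hk
    · simp
    · have hk' : (1 : ℝ) ≤ k := by exact_mod_cast hk
      have h1 := Real.log_le_rpow_div (by positivity : (0 : ℝ) ≤ k) (by norm_num : (0 : ℝ) < 1 / 2)
      have h2 : (1 : ℝ) ≤ (k : ℝ) ^ (1 / 2 : ℝ) := Real.one_le_rpow hk' (by norm_num)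
      have h3 : (k : ℝ) ^ 2 = (k : ℝ) ^ (1 / 2 : ℝ) * (k : ℝ) ^ (3 / 2 : ℝ) := by
        rw [← Real.rpow_add (by positivity)]
        norm_num
      rw [h3, mul_one_div, div_le_div_iff₀ (by positivity) (by positivity), ← mul_assoc]
      gcongr
      linarith

lemma LogMean.coprimeConv_log_pow (c e : ℕ) :
    LogMean (coprimeConv (fun x => Real.log x ^ c) (fun y => Real.log y ^ e))
      (6 / Real.pi ^ 2 * (c ! * e !)) (c + e + 1) := by
  obtain ⟨K, hK, h⟩ := exists_abs_sum_shift_sub_le c e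
  obtain ⟨B, hB⟩ := summable_one_add_log_div_sq
  have hB0 : 0 ≤ B := hB.nonneg fun k => by
    have := Real.log_natCast_nonneg k
    positivity
  refine ⟨K * B, by positivity, fun t ht => ?_⟩
  have hL : 0 ≤ Real.log t := Real.log_nonneg ht
  have h := h t ht
  rw [sum_coprimeConv_div]
  set C : ℝ := (e ! * c ! / (c + e + 1 + 1)! : ℝ) with hC
  set J : ℕ → ℝ := fun k => ∑ n ∈ Icc 1 (⌊t⌋₊ / k ^ 2),
    dirichletConv (fun x => Real.log (k * x : ℕ) ^ c) (fun y => Real.log (k * y : ℕ) ^ e) n / n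
    with hJ
  have hs1 : HasSum (fun k : ℕ => (ArithmeticFunction.moebius k : ℝ) / k ^ 2 * J k)
      (∑ k ∈ Icc 1 ⌊t⌋₊, (ArithmeticFunction.moebius k : ℝ) / k ^ 2 * J k) := by
    refine hasSum_sum_of_ne_finset_zero fun k hk => ?_
    rcases Nat.eq_zero_or_pos k with rfl | hk0
    · simp
    · have : ⌊t⌋₊ / k ^ 2 = 0 := by
        refine Nat.div_eq_of_lt ?_
        have : ⌊t⌋₊ < k := by
          by_contra! hle
          exact hk (mem_Icc.2 ⟨hk0, hle⟩)
        nlinarith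
      simp [hJ, this]
  have hs2 := hs1.sub (hasSum_moebius_div_sq.mul_right (C * Real.log t ^ (c + e + 1 + 1)))
  have hs3 := hB.mul_left (K * (1 + Real.log t) ^ (c + e + 1))
  have h4 := hs2.norm_le_of_bounded hs3 fun k => ?_
  · rw [Real.norm_eq_abs] at h4
    refine le_trans (le_of_eq ?_) (h4.trans (le_of_eq (by ring)))
    congr 2
    rw [hC]
    ring
  · rcases Nat.eq_zero_or_pos k with rfl | hk0
    · simp
    · rw [← mul_sub, Real.norm_eq_abs, abs_mul, abs_div, abs_of_nonneg (by positivity : 0 ≤ (k:ℝ) ^ 2)]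
      have hmu : |(ArithmeticFunction.moebius k : ℝ)| ≤ 1 := by
        exact_mod_cast ArithmeticFunction.abs_moebius_le_one (n := k)
      calc _ ≤ 1 / (k : ℝ) ^ 2 * (K * (1 + Real.log t) ^ (c + e + 1) * (1 + Real.log k)) := by
            gcongr
            exact h k hk0
        _ = _ := by ring

/-- Two factorizations of `n` are parametrized by a common refinement into four factors. -/
lemma sum_divisorsAntidiagonal_pairs (F : ℕ → ℕ → ℕ → ℕ → ℝ) (n : ℕ) :
    ∑ p ∈ n.divisorsAntidiagonal, ∑ q ∈ n.divisorsAntidiagonal, F p.1 p.2 q.1 q.2 =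
      ∑ u ∈ n.divisorsAntidiagonal, ∑ v ∈ u.2.divisorsAntidiagonal,
        ∑ w ∈ v.2.divisorsAntidiagonal, if w.1.Coprime w.2 then
          F (u.1 * w.1) (v.1 * w.2) (u.1 * w.2) (v.1 * w.1) else 0 := by
  simp_rw [← sum_filter]
  rw [← sum_product', sum_sigma', sum_sigma']
  symm
  refine sum_bij (fun s _ => ((s.1.1.1 * s.2.1, s.1.2.1 * s.2.2), (s.1.1.1 * s.2.2,
    s.1.2.1 * s.2.1))) ?_ ?_ ?_ ?_
  · rintro ⟨⟨⟨g, m⟩, ⟨h, k⟩⟩, ⟨x, y⟩⟩ hs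
    simp only [mem_sigma, mem_filter, Nat.mem_divisorsAntidiagonal, mem_product] at hs ⊢
    obtain ⟨⟨⟨rfl, h1⟩, rfl, h2⟩, ⟨rfl, h3⟩, h4⟩ := hs
    exact ⟨⟨by ring, h1⟩, by ring, h1⟩
  · rintro ⟨⟨⟨g, m⟩, ⟨h, k⟩⟩, ⟨x, y⟩⟩ hs ⟨⟨⟨g', m'⟩, ⟨h', k'⟩⟩, ⟨x', y'⟩⟩ hs' heq
    simp only [mem_sigma, mem_filter, Nat.mem_divisorsAntidiagonal] at hs hs'
    obtain ⟨⟨⟨h0, h1⟩, rfl, h2⟩, ⟨rfl, h3⟩, h4⟩ := hs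
    obtain ⟨⟨⟨h0', h1'⟩, rfl, h2'⟩, ⟨rfl, h3'⟩, h4'⟩ := hs'
    simp only [Prod.mk.injEq] at heq
    obtain ⟨⟨e1, e2⟩, e3, e4⟩ := heq
    have hg : g = g' := by
      have := Nat.gcd_mul_left g x y
      rw [e1, e3, Nat.gcd_mul_left, h4, h4'] at this
      simpa using this.symm
    subst hg
    have hg0 : 0 < g := Nat.pos_of_ne_zero (by rintro rfl; simp at h0; exact h1 h0.symm)
    have hx := Nat.eq_of_mul_eq_mul_left hg0 e1
    have hy := Nat.eq_of_mul_eq_mul_left hg0 e3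
    subst hx hy
    have hx0 : 0 < x := Nat.pos_of_ne_zero (by rintro rfl; simp at h3)
    have hh := Nat.eq_of_mul_eq_mul_right hx0 e4
    subst hh
    rfl
  · rintro ⟨⟨a, b⟩, ⟨c, d⟩⟩ hs
    simp only [mem_product, Nat.mem_divisorsAntidiagonal] at hs
    obtain ⟨⟨h1, h0⟩, h2, -⟩ := hs
    have ha : 0 < a := Nat.pos_of_ne_zero (by rintro rfl; simp at h1; exact h0 h1.symm)
    have hc : 0 < c := Nat.pos_of_ne_zero (by rintro rfl; simp at h2; exact h0 h2.symm)
    obtain ⟨x, y, hxy, hax, hcy⟩ := Nat.exists_coprime a c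
    set g := a.gcd c
    have hg : 0 < g := Nat.gcd_pos_of_pos_left _ ha
    rw [hax] at h1 ha
    rw [hcy] at h2 hc
    have hx0 : 0 < x := Nat.pos_of_ne_zero (by rintro rfl; simp at ha)
    have hy0 : 0 < y := Nat.pos_of_ne_zero (by rintro rfl; simp at hc)
    have hbd : x * b = y * d := by
      refine Nat.eq_of_mul_eq_mul_left hg ?_
      linarith
    obtain ⟨h, rfl⟩ : y ∣ b := hxy.symm.dvd_of_dvd_mul_left (Dvd.intro _ hbd.symm)
    have hd : d = x * h := by
      refine Nat.eq_of_mul_eq_mul_left hy0 ?_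
      linarith
    have hn : g * (h * (x * y)) = n := by rw [← h1]; ring
    have hh : h * (x * y) ≠ 0 := by rintro h'; rw [h', mul_zero] at hn; exact h0 hn.symm
    refine ⟨⟨⟨(g, h * (x * y)), (h, x * y)⟩, (x, y)⟩, ?_, ?_⟩
    · simp only [mem_sigma, mem_filter, Nat.mem_divisorsAntidiagonal]
      exact ⟨⟨⟨hn, h0⟩, trivial, hh⟩, ⟨trivial, right_ne_zero_of_mul hh⟩, hxy⟩
    · simp only [Prod.mk.injEq]
      refine ⟨⟨?_, ?_⟩, ?_, ?_⟩
      · rw [hax]; ring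
      · ring
      · rw [hcy]; ring
      · rw [hd]; ring
  · intro s hs
    rfl

/-- Weighted count of the factorizations `n = g * h * x * y` with `x` and `y` coprime, the weights
being powers of the logarithms of the factors. -/
noncomputable def quadLog (a b c e : ℕ) : ℕ → ℝ :=
  dirichletConv (fun n => Real.log n ^ a) (dirichletConv (fun n => Real.log n ^ b)
    (coprimeConv (fun x => Real.log x ^ c) (fun y => Real.log y ^ e)))

lemma quadLog_apply (a b c e n : ℕ) : quadLog a b c e n =
    ∑ u ∈ n.divisorsAntidiagonal, ∑ v ∈ u.2.divisorsAntidiagonal,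
      ∑ w ∈ v.2.divisorsAntidiagonal, if w.1.Coprime w.2 then
        Real.log u.1 ^ a * Real.log v.1 ^ b * Real.log w.1 ^ c * Real.log w.2 ^ e else 0 := by
  simp only [quadLog, dirichletConv, coprimeConv, mul_sum, mul_ite, mul_zero, mul_assoc]

lemma logMean_quadLog (a b c e : ℕ) : LogMean (quadLog a b c e)
    (6 / Real.pi ^ 2 * (c ! * e !) * b ! * a !) (a + (b + (c + e + 1) + 1) + 1) :=
  ((LogMean.coprimeConv_log_pow c e).log_pow_conv b).log_pow_conv a

lemma sum_refinement_congr {n : ℕ} {f f' : ℕ → ℕ → ℕ → ℕ → ℝ}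
    (h : ∀ g h x y : ℕ, 1 ≤ g → 1 ≤ h → 1 ≤ x → 1 ≤ y → f g h x y = f' g h x y) :
    (∑ u ∈ n.divisorsAntidiagonal, ∑ v ∈ u.2.divisorsAntidiagonal,
      ∑ w ∈ v.2.divisorsAntidiagonal, if w.1.Coprime w.2 then f u.1 v.1 w.1 w.2 else 0) =
    ∑ u ∈ n.divisorsAntidiagonal, ∑ v ∈ u.2.divisorsAntidiagonal,
      ∑ w ∈ v.2.divisorsAntidiagonal, if w.1.Coprime w.2 then f' u.1 v.1 w.1 w.2 else 0 := by
  have pos : ∀ {n : ℕ} {x : ℕ × ℕ}, x ∈ n.divisorsAntidiagonal → 1 ≤ x.1 ∧ 1 ≤ x.2 := by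
    intro n x hx
    obtain ⟨rfl, h⟩ := Nat.mem_divisorsAntidiagonal.1 hx
    exact ⟨Nat.pos_of_ne_zero (left_ne_zero_of_mul h), Nat.pos_of_ne_zero (right_ne_zero_of_mul h)⟩
  refine sum_congr rfl fun u hu => sum_congr rfl fun v hv => sum_congr rfl fun w hw => ?_
  rw [h _ _ _ _ (pos hu).1 (pos hv).1 (pos hw).1 (pos hw).2]

lemma log_natCast_mul {a b : ℕ} (ha : 1 ≤ a) (hb : 1 ≤ b) :
    Real.log (a * b : ℕ) = Real.log a + Real.log b := by
  push_cast
  exact Real.log_mul (by positivity) (by positivity)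

lemma dOne_mul_dOne_eq (n : ℕ) : dOne n * dOne n =
    quadLog 2 0 0 0 n + quadLog 1 0 0 1 n + quadLog 1 0 1 0 n + quadLog 0 0 1 1 n := by
  rw [dOne, sum_mul_sum,
    sum_divisorsAntidiagonal_pairs (fun a _ c _ => Real.log a * Real.log c) n,
    sum_refinement_congr (f := fun g h x y => Real.log (g * x : ℕ) * Real.log (g * y : ℕ))
      (f' := fun g h x y => Real.log g ^ 2 * Real.log h ^ 0 * Real.log x ^ 0 * Real.log y ^ 0 +
        Real.log g ^ 1 * Real.log h ^ 0 * Real.log x ^ 0 * Real.log y ^ 1 +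
        Real.log g ^ 1 * Real.log h ^ 0 * Real.log x ^ 1 * Real.log y ^ 0 +
        Real.log g ^ 0 * Real.log h ^ 0 * Real.log x ^ 1 * Real.log y ^ 1)]
  · simp only [quadLog_apply, ← sum_add_distrib]
    refine sum_congr rfl fun u _ => sum_congr rfl fun v _ => sum_congr rfl fun w _ => ?_
    split_ifs <;> ring
  · intro g h x y hg hh hx hy
    rw [log_natCast_mul hg hx, log_natCast_mul hg hy]
    ring

lemma dOne_mul_alphaFn_eq (n : ℕ) : dOne n * alphaFn n =
    quadLog 2 1 0 0 n + quadLog 2 0 1 0 n + quadLog 1 1 0 1 n + quadLog 1 0 1 1 n +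
      quadLog 1 1 1 0 n + quadLog 1 0 2 0 n + quadLog 0 1 1 1 n + quadLog 0 0 2 1 n := by
  rw [dOne, alphaFn, sum_mul_sum,
    sum_divisorsAntidiagonal_pairs (fun a _ c d => Real.log a * (Real.log c * Real.log d)) n,
    sum_refinement_congr (f := fun g h x y => Real.log (g * x : ℕ) *
        (Real.log (g * y : ℕ) * Real.log (h * x : ℕ)))
      (f' := fun g h x y => Real.log g ^ 2 * Real.log h ^ 1 * Real.log x ^ 0 * Real.log y ^ 0 +
        Real.log g ^ 2 * Real.log h ^ 0 * Real.log x ^ 1 * Real.log y ^ 0 +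
        Real.log g ^ 1 * Real.log h ^ 1 * Real.log x ^ 0 * Real.log y ^ 1 +
        Real.log g ^ 1 * Real.log h ^ 0 * Real.log x ^ 1 * Real.log y ^ 1 +
        Real.log g ^ 1 * Real.log h ^ 1 * Real.log x ^ 1 * Real.log y ^ 0 +
        Real.log g ^ 1 * Real.log h ^ 0 * Real.log x ^ 2 * Real.log y ^ 0 +
        Real.log g ^ 0 * Real.log h ^ 1 * Real.log x ^ 1 * Real.log y ^ 1 +
        Real.log g ^ 0 * Real.log h ^ 0 * Real.log x ^ 2 * Real.log y ^ 1)]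
  · simp only [quadLog_apply, ← sum_add_distrib]
    refine sum_congr rfl fun u _ => sum_congr rfl fun v _ => sum_congr rfl fun w _ => ?_
    split_ifs <;> ring
  · intro g h x y hg hh hx hy
    rw [log_natCast_mul hg hx, log_natCast_mul hg hy, log_natCast_mul hh hx]
    ring

lemma card_divisorsAntidiagonal_sq_eq (n : ℕ) :
    (n.divisorsAntidiagonal.card : ℝ) ^ 2 = quadLog 0 0 0 0 n := by
  have := sum_divisorsAntidiagonal_pairs (fun _ _ _ _ => (1 : ℝ)) n
  simp only [quadLog_apply, pow_zero, mul_one]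
  rw [← this]
  simp [sq]

lemma LogMean.dOne_mul_dOne : LogMean (fun n => dOne n * dOne n) (6 / Real.pi ^ 2 * 5) 5 := by
  have h := (((logMean_quadLog 2 0 0 0).add (logMean_quadLog 1 0 0 1)).add
    (logMean_quadLog 1 0 1 0)).add (logMean_quadLog 0 0 1 1)
  have e : (6 / Real.pi ^ 2 * 5 : ℝ) = 6 / Real.pi ^ 2 * (0 ! * 0 !) * 0 ! * 2 ! +
      6 / Real.pi ^ 2 * (0 ! * 1 !) * 0 ! * 1 ! + 6 / Real.pi ^ 2 * (1 ! * 0 !) * 0 ! * 1 ! +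
      6 / Real.pi ^ 2 * (1 ! * 1 !) * 0 ! * 0 ! := by
    simp only [Nat.factorial]
    push_cast
    ring
  rw [e]
  exact h.congr fun n _ => (dOne_mul_dOne_eq n).symm

lemma LogMean.dOne_mul_alphaFn :
    LogMean (fun n => dOne n * alphaFn n) (6 / Real.pi ^ 2 * 12) 6 := by
  have h := (((((((logMean_quadLog 2 1 0 0).add (logMean_quadLog 2 0 1 0)).add
    (logMean_quadLog 1 1 0 1)).add (logMean_quadLog 1 0 1 1)).add (logMean_quadLog 1 1 1 0)).add
    (logMean_quadLog 1 0 2 0)).add (logMean_quadLog 0 1 1 1)).add (logMean_quadLog 0 0 2 1)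
  have e : (6 / Real.pi ^ 2 * 12 : ℝ) = 6 / Real.pi ^ 2 * (0 ! * 0 !) * 1 ! * 2 ! +
      6 / Real.pi ^ 2 * (1 ! * 0 !) * 0 ! * 2 ! + 6 / Real.pi ^ 2 * (0 ! * 1 !) * 1 ! * 1 ! +
      6 / Real.pi ^ 2 * (1 ! * 1 !) * 0 ! * 1 ! + 6 / Real.pi ^ 2 * (1 ! * 0 !) * 1 ! * 1 ! +
      6 / Real.pi ^ 2 * (2 ! * 0 !) * 0 ! * 1 ! + 6 / Real.pi ^ 2 * (1 ! * 1 !) * 1 ! * 0 ! +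
      6 / Real.pi ^ 2 * (2 ! * 1 !) * 0 ! * 0 ! := by
    simp only [Nat.factorial]
    push_cast
    ring
  rw [e]
  exact h.congr fun n _ => (dOne_mul_alphaFn_eq n).symm

lemma sum_divisorsAntidiagonal_dvd_fst (f : ℕ → ℕ → ℝ) {p : ℕ} (hp : 1 ≤ p) (n : ℕ) :
    (∑ x ∈ (p * n).divisorsAntidiagonal, if p ∣ x.1 then f x.1 x.2 else 0) =
      ∑ x ∈ n.divisorsAntidiagonal, f (p * x.1) x.2 := by
  rw [← sum_filter]
  symm
  refine sum_bij (fun x _ => (p * x.1, x.2)) ?_ ?_ ?_ ?_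
  · intro x hx
    obtain ⟨rfl, h⟩ := Nat.mem_divisorsAntidiagonal.1 hx
    rw [mem_filter, Nat.mem_divisorsAntidiagonal]
    exact ⟨⟨by ring, mul_ne_zero (by lia) h⟩, dvd_mul_right _ _⟩
  · intro x _ y _ h
    simp only [Prod.mk.injEq] at h
    exact Prod.ext (Nat.eq_of_mul_eq_mul_left hp h.1) h.2
  · rintro ⟨a, b⟩ hx
    obtain ⟨hx, c, hc⟩ := mem_filter.1 hx
    obtain ⟨h1, h2⟩ := Nat.mem_divisorsAntidiagonal.1 hx
    simp only at hc h1
    subst hc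
    refine ⟨(c, b), Nat.mem_divisorsAntidiagonal.2 ⟨?_, right_ne_zero_of_mul h2⟩, rfl⟩
    rw [mul_assoc] at h1
    exact Nat.eq_of_mul_eq_mul_left hp h1
  · intro x _
    rfl

lemma sum_divisorsAntidiagonal_swap (f : ℕ → ℕ → ℝ) (n : ℕ) :
    ∑ x ∈ n.divisorsAntidiagonal, f x.1 x.2 = ∑ x ∈ n.divisorsAntidiagonal, f x.2 x.1 := by
  conv_lhs => rw [← Nat.map_swap_divisorsAntidiagonal, sum_map]
  rfl

lemma sum_divisorsAntidiagonal_dvd_snd (f : ℕ → ℕ → ℝ) {p : ℕ} (hp : 1 ≤ p) (n : ℕ) :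
    (∑ x ∈ (p * n).divisorsAntidiagonal, if p ∣ x.2 then f x.1 x.2 else 0) =
      ∑ x ∈ n.divisorsAntidiagonal, f x.1 (p * x.2) := by
  rw [sum_divisorsAntidiagonal_swap (fun a b => if p ∣ b then f a b else 0),
    sum_divisorsAntidiagonal_dvd_fst (fun a b => f b a) hp,
    sum_divisorsAntidiagonal_swap (fun a b => f b (p * a))]

lemma sum_divisorsAntidiagonal_prime_mul (f : ℕ → ℕ → ℝ) {p : ℕ} (hp : p.Prime) {n : ℕ}
    (hn : 1 ≤ n) :
    ∑ x ∈ (p * n).divisorsAntidiagonal, f x.1 x.2 =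
      ∑ x ∈ n.divisorsAntidiagonal, f (p * x.1) x.2 +
        ∑ x ∈ n.divisorsAntidiagonal, f x.1 (p * x.2) -
        if p ∣ n then ∑ x ∈ (n / p).divisorsAntidiagonal, f (p * x.1) (p * x.2) else 0 := by
  have h1 : (∑ x ∈ (p * n).divisorsAntidiagonal,
      if p ∣ x.1 then if p ∣ x.2 then f x.1 x.2 else 0 else 0) =
      if p ∣ n then ∑ x ∈ (n / p).divisorsAntidiagonal, f (p * x.1) (p * x.2) else 0 := by
    rw [sum_divisorsAntidiagonal_dvd_fst (fun a b => if p ∣ b then f a b else 0) hp.one_le]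
    split_ifs with h
    · obtain ⟨m, rfl⟩ := h
      rw [Nat.mul_div_cancel_left _ hp.pos,
        sum_divisorsAntidiagonal_dvd_snd (fun a b => f (p * a) b) hp.one_le]
    · refine sum_eq_zero fun x hx => if_neg fun h' => h (h'.trans ?_)
      rw [← (Nat.mem_divisorsAntidiagonal.1 hx).1]
      exact dvd_mul_left _ _
  rw [← h1, ← sum_divisorsAntidiagonal_dvd_fst f hp.one_le,
    ← sum_divisorsAntidiagonal_dvd_snd f hp.one_le, ← sum_add_distrib, ← sum_sub_distrib]
  refine sum_congr rfl fun x hx => ?_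
  have h2 : p ∣ x.1 ∨ p ∣ x.2 := by
    rw [← hp.dvd_mul, (Nat.mem_divisorsAntidiagonal.1 hx).1]
    exact dvd_mul_right _ _
  split_ifs <;> simp_all

lemma card_divisorsAntidiagonal_prime_mul_le {p : ℕ} (hp : p.Prime) {n : ℕ} (hn : 1 ≤ n) :
    ((p * n).divisorsAntidiagonal.card : ℝ) ≤ 2 * n.divisorsAntidiagonal.card := by
  have h := sum_divisorsAntidiagonal_prime_mul (fun _ _ => 1) hp hn
  simp only [sum_const, nsmul_eq_mul, mul_one] at h
  rw [h, two_mul]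
  refine sub_le_self _ ?_
  split_ifs <;> positivity

lemma log_mem_Icc_of_mem_divisorsAntidiagonal {n : ℕ} {x : ℕ × ℕ}
    (hx : x ∈ n.divisorsAntidiagonal) :
    0 ≤ Real.log x.1 ∧ 0 ≤ Real.log x.2 ∧ Real.log x.1 ≤ Real.log n ∧
      Real.log x.2 ≤ Real.log n := by
  obtain ⟨rfl, h⟩ := Nat.mem_divisorsAntidiagonal.1 hx
  have h1 := Nat.pos_of_ne_zero (left_ne_zero_of_mul h)
  have h2 := Nat.pos_of_ne_zero (right_ne_zero_of_mul h)
  rw [log_natCast_mul h1 h2]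
  have := Real.log_natCast_nonneg x.1
  have := Real.log_natCast_nonneg x.2
  refine ⟨?_, ?_, ?_, ?_⟩ <;> linarith

lemma dOne_nonneg (n : ℕ) : 0 ≤ dOne n := sum_nonneg fun x _ => Real.log_natCast_nonneg x.1

lemma dOne_le (n : ℕ) : dOne n ≤ n.divisorsAntidiagonal.card * Real.log n := by
  rw [← nsmul_eq_mul]
  exact sum_le_card_nsmul _ _ _ fun x hx => (log_mem_Icc_of_mem_divisorsAntidiagonal hx).2.2.1

lemma alphaFn_prime_mul {p : ℕ} (hp : p.Prime) {n : ℕ} (hn : 1 ≤ n) :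
    alphaFn (p * n) = 2 * alphaFn n + 2 * Real.log p * dOne n -
      if p ∣ n then ∑ x ∈ (n / p).divisorsAntidiagonal,
        Real.log (p * x.1 : ℕ) * Real.log (p * x.2 : ℕ) else 0 := by
  rw [alphaFn, sum_divisorsAntidiagonal_prime_mul (fun a b => Real.log a * Real.log b) hp hn]
  congr 1
  have h1 : ∑ x ∈ n.divisorsAntidiagonal, Real.log (p * x.1 : ℕ) * Real.log x.2 =
      Real.log p * dOne n + alphaFn n := by
    rw [dOne, sum_divisorsAntidiagonal_swap (fun a _ => Real.log a), alphaFn, mul_sum,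
      ← sum_add_distrib]
    refine sum_congr rfl fun x hx => ?_
    obtain ⟨rfl, h⟩ := Nat.mem_divisorsAntidiagonal.1 hx
    rw [log_natCast_mul hp.one_le (Nat.pos_of_ne_zero (left_ne_zero_of_mul h))]
    ring
  rw [sum_divisorsAntidiagonal_swap (fun a b => Real.log a * Real.log (p * b : ℕ))]
  simp only [mul_comm (Real.log _) (Real.log (p * _ : ℕ))] at h1 ⊢
  rw [h1]
  ring

lemma dOne_prime_mul_div_le {p m : ℕ} {t : ℝ} (hp : p.Prime) (hm : 1 ≤ m)
    (ht : ((p * m : ℕ) : ℝ) ≤ t) :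
    dOne (p * m) * (∑ x ∈ m.divisorsAntidiagonal,
        Real.log (p * x.1 : ℕ) * Real.log (p * x.2 : ℕ)) / (p * m : ℕ) ≤
      2 * Real.log t ^ 3 / p * (quadLog 0 0 0 0 m / m) := by
  have hp0 : (0 : ℝ) < p := by exact_mod_cast hp.pos
  have hm0 : (0 : ℝ) < m := by exact_mod_cast hm
  have hlog : ∀ k : ℕ, 1 ≤ k → k ≤ m → Real.log (p * k : ℕ) ≤ Real.log t := by
    intro k hk hkm
    have hk0 : 0 < p * k := Nat.mul_pos hp.pos hk
    refine Real.log_le_log (by exact_mod_cast hk0) (le_trans ?_ ht)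
    exact_mod_cast Nat.mul_le_mul_left p hkm
  have hL : 0 ≤ Real.log t := (Real.log_natCast_nonneg _).trans (hlog m hm le_rfl)
  have h1 : dOne (p * m) ≤ 2 * m.divisorsAntidiagonal.card * Real.log t :=
    (dOne_le _).trans (mul_le_mul (card_divisorsAntidiagonal_prime_mul_le hp hm)
      (hlog m hm le_rfl) (Real.log_natCast_nonneg _) (by positivity))
  have h2 : ∑ x ∈ m.divisorsAntidiagonal, Real.log (p * x.1 : ℕ) * Real.log (p * x.2 : ℕ) ≤
      m.divisorsAntidiagonal.card * Real.log t ^ 2 := by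
    rw [← nsmul_eq_mul]
    refine sum_le_card_nsmul _ _ _ fun x hx => ?_
    obtain ⟨rfl, h⟩ := Nat.mem_divisorsAntidiagonal.1 hx
    have ha := Nat.pos_of_ne_zero (left_ne_zero_of_mul h)
    have hb := Nat.pos_of_ne_zero (right_ne_zero_of_mul h)
    rw [sq]
    exact mul_le_mul (hlog _ ha (Nat.le_mul_of_pos_right _ hb))
      (hlog _ hb (Nat.le_mul_of_pos_left _ ha)) (Real.log_natCast_nonneg _) hL
  have h3 : 0 ≤ ∑ x ∈ m.divisorsAntidiagonal,
      Real.log (p * x.1 : ℕ) * Real.log (p * x.2 : ℕ) :=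
    sum_nonneg fun x _ => mul_nonneg (Real.log_natCast_nonneg _) (Real.log_natCast_nonneg _)
  rw [← card_divisorsAntidiagonal_sq_eq]
  calc _ ≤ 2 * m.divisorsAntidiagonal.card * Real.log t *
        (m.divisorsAntidiagonal.card * Real.log t ^ 2) / (p * m : ℕ) := by
        gcongr
    _ = _ := by
        push_cast
        field_simp

lemma sum_dvd_dOne_div_le {p : ℕ} {t : ℝ} (hp : p.Prime) (ht : 1 ≤ t) :
    (∑ n ∈ Icc 1 ⌊t⌋₊, if p ∣ n then dOne n * (∑ x ∈ (n / p).divisorsAntidiagonal,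
        Real.log (p * x.1 : ℕ) * Real.log (p * x.2 : ℕ)) / n else 0) ≤
      2 * Real.log t ^ 3 / p * ∑ m ∈ Icc 1 ⌊t⌋₊, quadLog 0 0 0 0 m / m := by
  have hL := Real.log_nonneg ht
  have h : ∀ n ∈ Icc 1 ⌊t⌋₊, (if p ∣ n then dOne n * (∑ x ∈ (n / p).divisorsAntidiagonal,
        Real.log (p * x.1 : ℕ) * Real.log (p * x.2 : ℕ)) / n else 0) =
      if p ∣ n then if n ≤ ⌊t⌋₊ then dOne n * (∑ x ∈ (n / p).divisorsAntidiagonal,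
        Real.log (p * x.1 : ℕ) * Real.log (p * x.2 : ℕ)) / n else 0 else 0 := fun n hn => by
    rw [if_pos (mem_Icc.1 hn).2]
  rw [sum_congr rfl h, sum_Icc_dvd _ hp.one_le fun x hx => if_neg (not_le.2 hx), mul_sum]
  refine sum_le_sum fun m hm => ?_
  have hm1 := (mem_Icc.1 hm).1
  split_ifs with hle
  · rw [Nat.mul_div_cancel_left _ hp.pos]
    exact dOne_prime_mul_div_le hp hm1 ((Nat.le_floor_iff (by linarith)).1 hle)
  · rw [← card_divisorsAntidiagonal_sq_eq]
    positivity

theorem dOne_alpha_shifted_sum :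
    ∃ K : ℝ, 0 < K ∧ ∀ t : ℝ, 3 ≤ t → ∀ p : ℕ, p.Prime → (p : ℝ) ≤ t →
      |(∑ n ∈ Finset.Icc 1 ⌊t⌋₊, dOne n * alphaFn (p * n) / n) -
          6 / Real.pi ^ 2 *
            (1 / 210 * Real.log t ^ 7 + 1 / 72 * Real.log t ^ 6 * Real.log p)|
        ≤ K * (Real.log t ^ 6 + Real.log t ^ 7 / p) := by
  obtain ⟨K₁, hK₁, h₁⟩ := LogMean.dOne_mul_alphaFn
  obtain ⟨K₂, hK₂, h₂⟩ := LogMean.dOne_mul_dOne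
  obtain ⟨K₃, hK₃, h₃⟩ := (logMean_quadLog 0 0 0 0).exists_abs_sum_le
  refine ⟨128 * K₁ + 64 * K₂ + 32 * K₃ + 1, by positivity, fun t ht p hp hpt => ?_⟩
  have ht1 : 1 ≤ t := by linarith
  have hp0 : (0 : ℝ) < p := by exact_mod_cast hp.pos
  replace h₁ := h₁ t ht1
  replace h₂ := h₂ t ht1
  replace h₃ := h₃ t ht1
  have hR := sum_dvd_dOne_div_le hp ht1
  set R := ∑ n ∈ Icc 1 ⌊t⌋₊, if p ∣ n then dOne n * (∑ x ∈ (n / p).divisorsAntidiagonal,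
        Real.log (p * x.1 : ℕ) * Real.log (p * x.2 : ℕ)) / n else 0 with hRdef
  have hR0 : 0 ≤ R := sum_nonneg fun n _ => by
    split_ifs
    · exact div_nonneg (mul_nonneg (dOne_nonneg n) (sum_nonneg fun x _ =>
        mul_nonneg (Real.log_natCast_nonneg _) (Real.log_natCast_nonneg _))) n.cast_nonneg
    · exact le_rfl
  have hsum : ∑ n ∈ Icc 1 ⌊t⌋₊, dOne n * alphaFn (p * n) / n =
      2 * (∑ n ∈ Icc 1 ⌊t⌋₊, dOne n * alphaFn n / n) +
        2 * Real.log p * (∑ n ∈ Icc 1 ⌊t⌋₊, dOne n * dOne n / n) - R := by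
    rw [hRdef, mul_sum, mul_sum, ← sum_add_distrib, ← sum_sub_distrib]
    refine sum_congr rfl fun n hn => ?_
    rw [alphaFn_prime_mul hp (mem_Icc.1 hn).1]
    split_ifs <;> ring
  rw [hsum]
  have hlogp : Real.log p ≤ Real.log t := Real.log_le_log hp0 hpt
  have hlogp0 : 0 ≤ Real.log p := Real.log_natCast_nonneg p
  have hL : 1 ≤ Real.log t := by
    rw [Real.le_log_iff_exp_le (by linarith)]
    linarith [Real.exp_one_lt_d9]
  set L := Real.log t
  set A := ∑ n ∈ Icc 1 ⌊t⌋₊, dOne n * alphaFn n / n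
  set B := ∑ n ∈ Icc 1 ⌊t⌋₊, dOne n * dOne n / n
  have hpow : ∀ k : ℕ, (1 + L) ^ k ≤ 2 ^ k * L ^ k := fun k => by
    rw [← mul_pow]
    gcongr
    linarith
  have e₁ : |2 * (A - 6 / Real.pi ^ 2 * 12 / (6 + 1)! * L ^ (6 + 1))| ≤ 128 * K₁ * L ^ 6 := by
    rw [abs_mul, abs_two]
    have := mul_le_mul_of_nonneg_left (hpow 6) hK₁
    linarith
  have e₂ : |2 * Real.log p * (B - 6 / Real.pi ^ 2 * 5 / (5 + 1)! * L ^ (5 + 1))| ≤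
      64 * K₂ * L ^ 6 := by
    rw [abs_mul, abs_of_nonneg (by positivity)]
    calc _ ≤ 2 * L * (K₂ * (2 ^ 5 * L ^ 5)) := by
          refine mul_le_mul (by linarith) (h₂.trans ?_) (abs_nonneg _) (by linarith)
          exact mul_le_mul_of_nonneg_left (hpow 5) hK₂
      _ = _ := by ring
  have e₃ : R ≤ 32 * K₃ * (L ^ 7 / p) := by
    calc R ≤ 2 * L ^ 3 / p * (K₃ * (2 ^ 4 * L ^ 4)) := by
          refine hR.trans (mul_le_mul_of_nonneg_left ?_ (by positivity))
          exact ((le_abs_self _).trans h₃).trans (mul_le_mul_of_nonneg_left (hpow 4) hK₃)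
      _ = _ := by ring
  have e : 2 * A + 2 * Real.log p * B - R -
      6 / Real.pi ^ 2 * (1 / 210 * L ^ 7 + 1 / 72 * L ^ 6 * Real.log p) =
      2 * (A - 6 / Real.pi ^ 2 * 12 / (6 + 1)! * L ^ (6 + 1)) +
        2 * Real.log p * (B - 6 / Real.pi ^ 2 * 5 / (5 + 1)! * L ^ (5 + 1)) - R := by
    simp only [Nat.factorial]
    push_cast
    ring
  rw [e]
  have hL6 : 0 ≤ L ^ 6 := by positivity
  have hL7 : 0 ≤ L ^ 7 / p := by positivity
  have q₁ := mul_nonneg hK₁ hL7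
  have q₂ := mul_nonneg hK₂ hL7
  have q₃ := mul_nonneg hK₃ hL6
  rw [abs_le] at e₁ e₂ ⊢
  constructor <;> nlinarith
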